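/- For every integer k with 2 ≤ k and 2k ≤ n and every sign ε ∈ {1,−1}, the B-orbit { b·X_{k,ε}·b⁻¹ : b ∈ B } is dense in the orbit O_{k,ε}: every element of O_{k,ε} is a limit (in the space of n×n real matrices) of elements of the form b·X_{k,ε}·b⁻¹ with b ∈ B. -/

import Mathlib

open Matrix

/-- The n×n real matrix unit `E_{a,b}` (1-based indices). -/
noncomputable def Ematrix (n a b : ℕ) : Matrix (Fin n) (Fin n) ℝ :=
  fun s t => if (s : ℕ) + 1 = a ∧ (t : ℕ) + 1 = b then 1 else 0

/-- `X_{k,ε} = Σ_{i=1}^{k−1} E_{n+1−i,i} + ε·E_{n+1−k,k}`. -/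
noncomputable def Xmat (n k : ℕ) (ε : ℝ) : Matrix (Fin n) (Fin n) ℝ :=
  (∑ i ∈ Finset.Icc 1 (k - 1), Ematrix n (n + 1 - i) i) + ε • Ematrix n (n + 1 - k) k

/-- The spherical nilpotent orbit `O_{k,ε} = { g·X_{k,ε}·g⁻¹ : g ∈ SL_n(ℝ) }`. -/
def Orb (n k : ℕ) (ε : ℝ) : Set (Matrix (Fin n) (Fin n) ℝ) :=
  {M | ∃ g : Matrix.SpecialLinearGroup (Fin n) ℝ, g.val * Xmat n k ε * (g⁻¹).val = M}

/-- The `B`-orbit `{ b·X_{k,ε}·b⁻¹ : b ∈ B }`, `B` the upper-triangular Borel subgroup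
of `SL_n(ℝ)`. -/
def BOrb (n k : ℕ) (ε : ℝ) : Set (Matrix (Fin n) (Fin n) ℝ) :=
  {M | ∃ b : Matrix.SpecialLinearGroup (Fin n) ℝ,
    (∀ s t : Fin n, (t : ℕ) < (s : ℕ) → b.val s t = 0) ∧
    b.val * Xmat n k ε * (b⁻¹).val = M}


/-- The coefficient of the matrix unit in column `t` of `Xmat n k ε`. -/
noncomputable def xCoeff (k : ℕ) (ε : ℝ) (t : ℕ) : ℝ := if t + 1 = k then ε else 1

lemma xCoeff_mul_self {k : ℕ} {ε : ℝ} (hε : ε = 1 ∨ ε = -1) (t : ℕ) :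
    xCoeff k ε t * xCoeff k ε t = 1 := by
  unfold xCoeff
  split_ifs
  · rcases hε with rfl | rfl <;> norm_num
  · norm_num

lemma xCoeff_ne_zero {k : ℕ} {ε : ℝ} (hε : ε = 1 ∨ ε = -1) (t : ℕ) : xCoeff k ε t ≠ 0 :=
  left_ne_zero_of_mul_eq_one (xCoeff_mul_self hε t)

lemma Xmat_apply {n k : ℕ} (hk : 2 ≤ k) (hkn : 2 * k ≤ n) (ε : ℝ) (s t : Fin n) :
    Xmat n k ε s t = if (t : ℕ) < k ∧ s = t.rev then xCoeff k ε t else 0 := by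
  have hs := s.isLt
  have ht := t.isLt
  have hrev : s = t.rev ↔ (s : ℕ) + t + 1 = n := by
    rw [Fin.ext_iff, Fin.val_rev]; omega
  simp only [Xmat, Matrix.add_apply, Matrix.sum_apply, Matrix.smul_apply, Ematrix, smul_eq_mul,
    hrev, xCoeff]
  have hsum : (∑ i ∈ Finset.Icc 1 (k - 1),
      if (s : ℕ) + 1 = n + 1 - i ∧ (t : ℕ) + 1 = i then (1 : ℝ) else 0) =
      if (t : ℕ) + 1 < k ∧ (s : ℕ) + t + 1 = n then 1 else 0 := by
    simp only [and_comm (b := (t : ℕ) + 1 = _), ite_and, Finset.sum_ite_eq, Finset.mem_Icc]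
    split_ifs <;> first | rfl | omega
  rw [hsum]
  split_ifs <;> first | omega | simp

lemma mul_Xmat_apply {n k : ℕ} (hk : 2 ≤ k) (hkn : 2 * k ≤ n) (ε : ℝ)
    (b : Matrix (Fin n) (Fin n) ℝ) (s t : Fin n) :
    (b * Xmat n k ε) s t = if (t : ℕ) < k then b s t.rev * xCoeff k ε t else 0 := by
  rw [Matrix.mul_apply]
  by_cases h : (t : ℕ) < k <;> simp [Xmat_apply hk hkn, h]

lemma Xmat_mul_apply {n k : ℕ} (hk : 2 ≤ k) (hkn : 2 * k ≤ n) (ε : ℝ)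
    (b : Matrix (Fin n) (Fin n) ℝ) (s t : Fin n) :
    (Xmat n k ε * b) s t =
      if (s.rev : ℕ) < k then xCoeff k ε s.rev * b s.rev t else 0 := by
  have hr : ∀ r : Fin n, s = r.rev ↔ r = s.rev := fun r => by
    rw [← Fin.rev_inj, Fin.rev_rev, eq_comm]
  rw [Matrix.mul_apply, Finset.sum_eq_single s.rev]
  · simp [Xmat_apply hk hkn]
  · intro r _ hne
    simp [Xmat_apply hk hkn, hr, hne]
  · simp

/-- The matrix obtained from the identity by replacing its leading `i × i` block by the lower-left
`i × i` block of `M` with its rows in reverse order. -/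
def cornerMatrix {R : Type*} [CommRing R] {n : ℕ} (i : ℕ) (M : Matrix (Fin n) (Fin n) R) :
    Matrix (Fin n) (Fin n) R :=
  Matrix.of fun s t => if (s : ℕ) < i ∧ (t : ℕ) < i then M s.rev t else if s = t then 1 else 0

lemma cornerMatrix_map {R S : Type*} [CommRing R] [CommRing S] (f : R →+* S) {n : ℕ} (i : ℕ)
    (M : Matrix (Fin n) (Fin n) R) :
    f.mapMatrix (cornerMatrix i M) = cornerMatrix i (f.mapMatrix M) := by
  ext s t
  simp only [cornerMatrix, RingHom.mapMatrix_apply, Matrix.map_apply, Matrix.of_apply]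
  split_ifs <;> simp

lemma cornerMatrix_smul {n : ℕ} (i : ℕ) (c : ℝ) (M : Matrix (Fin n) (Fin n) ℝ) :
    cornerMatrix i (c • M) =
      Matrix.diagonal (fun s : Fin n => if (s : ℕ) < i then c else 1) * cornerMatrix i M := by
  ext s t
  rw [Matrix.diagonal_mul]
  simp only [cornerMatrix, Matrix.of_apply, Matrix.smul_apply, smul_eq_mul]
  by_cases hs : (s : ℕ) < i
  · by_cases hst : s = t
    · simp [hs, ← hst]
    · by_cases ht : (t : ℕ) < i <;> simp [hs, ht, hst]
  · simp [hs]

lemma det_cornerMatrix_smul_ne_zero {n : ℕ} {i : ℕ} {c : ℝ} (hc : c ≠ 0)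
    {M : Matrix (Fin n) (Fin n) ℝ} (h : (cornerMatrix i M).det ≠ 0) :
    (cornerMatrix i (c • M)).det ≠ 0 := by
  rw [cornerMatrix_smul, Matrix.det_mul, Matrix.det_diagonal]
  refine mul_ne_zero (Finset.prod_ne_zero_iff.2 fun s _ => ?_) h
  split_ifs <;> simp [hc]

lemma det_cornerMatrix_Xmat_ne_zero {n k : ℕ} (hk : 2 ≤ k) (hkn : 2 * k ≤ n) {ε : ℝ}
    (hε : ε = 1 ∨ ε = -1) {i : ℕ} (hi : i ≤ k) :
    (cornerMatrix i (Xmat n k ε)).det ≠ 0 := by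
  have h : cornerMatrix i (Xmat n k ε) =
      Matrix.diagonal (fun s : Fin n => if (s : ℕ) < i then xCoeff k ε s else 1) := by
    ext s t
    simp only [cornerMatrix, Matrix.of_apply, Matrix.diagonal_apply, Xmat_apply hk hkn,
      Fin.rev_inj]
    by_cases hst : s = t
    · subst hst
      by_cases hs : (s : ℕ) < i
      · simp [hs, hs.trans_le hi]
      · simp [hs]
    · simp [hst]
  rw [h, Matrix.det_diagonal]
  refine Finset.prod_ne_zero_iff.2 fun s _ => ?_
  split_ifs <;> simp [xCoeff_ne_zero hε]

lemma cornerMatrix_mulVec_of_le {n i : ℕ} (M : Matrix (Fin n) (Fin n) ℝ) (v : Fin n → ℝ)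
    {s : Fin n} (hs : i ≤ (s : ℕ)) : (cornerMatrix i M *ᵥ v) s = v s := by
  simp [Matrix.mulVec, dotProduct, cornerMatrix, hs.not_gt]

lemma cornerMatrix_mulVec_of_lt {n i : ℕ} (M : Matrix (Fin n) (Fin n) ℝ) {v : Fin n → ℝ}
    (hv : ∀ t : Fin n, i ≤ (t : ℕ) → v t = 0) {s : Fin n} (hs : (s : ℕ) < i) :
    (cornerMatrix i M *ᵥ v) s = (M *ᵥ v) s.rev := by
  simp only [Matrix.mulVec, dotProduct, cornerMatrix, Matrix.of_apply]
  refine Finset.sum_congr rfl fun t _ => ?_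
  by_cases ht : (t : ℕ) < i
  · simp [hs, ht]
  · simp [hv t (not_lt.1 ht)]

/-- If the lower-left corner of size `i` is nonsingular, the last `i` entries of `M *ᵥ v` can be
prescribed by a vector `v` supported on the first `i` coordinates. -/
lemma exists_mulVec_rev_eq {n i : ℕ} {M : Matrix (Fin n) (Fin n) ℝ}
    (h : (cornerMatrix i M).det ≠ 0) (w : Fin n → ℝ) :
    ∃ v : Fin n → ℝ, (∀ t : Fin n, i ≤ (t : ℕ) → v t = 0) ∧
      ∀ s : Fin n, (s : ℕ) < i → (M *ᵥ v) s.rev = w s := by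
  set w' : Fin n → ℝ := fun s => if (s : ℕ) < i then w s else 0 with hw'
  set v := (cornerMatrix i M)⁻¹ *ᵥ w' with hv
  have hsol : cornerMatrix i M *ᵥ v = w' := by
    rw [hv, Matrix.mulVec_mulVec, Matrix.mul_nonsing_inv _ (isUnit_iff_ne_zero.2 h),
      Matrix.one_mulVec]
  have hsupp : ∀ t : Fin n, i ≤ (t : ℕ) → v t = 0 := fun t ht => by
    rw [← cornerMatrix_mulVec_of_le M v ht, hsol, hw']
    simp [ht.not_gt]
  refine ⟨v, hsupp, fun s hs => ?_⟩
  rw [← cornerMatrix_mulVec_of_lt M hsupp hs, hsol, hw']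
  simp [hs]

lemma eq_zero_of_mulVec_rev_eq_zero {n i : ℕ} {M : Matrix (Fin n) (Fin n) ℝ}
    (h : (cornerMatrix i M).det ≠ 0) {v : Fin n → ℝ} (hv : ∀ t : Fin n, i ≤ (t : ℕ) → v t = 0)
    (h0 : ∀ s : Fin n, (s : ℕ) < i → (M *ᵥ v) s.rev = 0) : v = 0 := by
  refine Matrix.eq_zero_of_mulVec_eq_zero h (funext fun s => ?_)
  by_cases hs : (s : ℕ) < i
  · rw [cornerMatrix_mulVec_of_lt M hv hs, h0 s hs, Pi.zero_apply]
  · rw [cornerMatrix_mulVec_of_le M v (not_lt.1 hs), hv s (not_lt.1 hs), Pi.zero_apply]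

lemma exists_pivot_vector {n : ℕ} {M : Matrix (Fin n) (Fin n) ℝ} (i : Fin n)
    (h : (cornerMatrix i M).det ≠ 0) (h' : (cornerMatrix (i + 1) M).det ≠ 0) :
    ∃ v : Fin n → ℝ, (∀ t, i < t → v t = 0) ∧ v i ≠ 0 ∧
      (∀ s, s < i → (M *ᵥ v) s.rev = 0) ∧ (M *ᵥ v) i.rev = 1 := by
  obtain ⟨v, hsupp, hv⟩ := exists_mulVec_rev_eq h' (Pi.single i 1)
  have hlt : ∀ s, s < i → (M *ᵥ v) s.rev = 0 := fun s hs => by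
    rw [hv s (by rw [Fin.lt_def] at hs; omega), Pi.single_eq_of_ne hs.ne]
  have hi : (M *ᵥ v) i.rev = 1 := by rw [hv i (by omega), Pi.single_eq_same]
  refine ⟨v, fun t ht => hsupp t ht, fun h0 => ?_, hlt, hi⟩
  have : v = 0 := by
    refine eq_zero_of_mulVec_rev_eq_zero h (fun t ht => ?_) fun s hs => hlt s hs
    rcases ht.eq_or_lt with hti | hti
    · rwa [← Fin.ext hti]
    · exact hsupp t hti
  simp [this] at hi

lemma rank_Xmat_le {n k : ℕ} (hk : 2 ≤ k) (hkn : 2 * k ≤ n) (ε : ℝ) :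
    (Xmat n k ε).rank ≤ k := by
  have h : Xmat n k ε =
      Xmat n k ε * Matrix.diagonal (fun t : Fin n => if (t : ℕ) < k then (1 : ℝ) else 0) := by
    ext s t
    rw [Matrix.mul_diagonal, Xmat_apply hk hkn]
    by_cases ht : (t : ℕ) < k <;> simp [ht]
  rw [h]
  refine (Matrix.rank_mul_le_right _ _).trans ?_
  rw [Matrix.rank_diagonal]
  have hcard := Fintype.card_le_of_injective
    (fun t : {t : Fin n // (if (t : ℕ) < k then (1 : ℝ) else 0) ≠ 0} =>
      (⟨t.1, by by_contra hc; exact t.2 (if_neg hc)⟩ : Fin k))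
    fun a b hab => Subtype.ext (Fin.ext (by simpa using hab))
  simpa using hcard

lemma mulVec_eq_zero_of_rank_le {n k : ℕ} (hkn : k ≤ n) {M : Matrix (Fin n) (Fin n) ℝ}
    (hrank : M.rank ≤ k) (h : (cornerMatrix k M).det ≠ 0) {v : Fin n → ℝ}
    (hv : ∀ s : Fin n, (s : ℕ) < k → (M *ᵥ v) s.rev = 0) : M *ᵥ v = 0 := by
  let φ : LinearMap.range M.mulVecLin →ₗ[ℝ] (Fin k → ℝ) :=
    (LinearMap.funLeft ℝ ℝ fun s : Fin k => (Fin.castLE hkn s).rev) ∘ₗ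
      (LinearMap.range M.mulVecLin).subtype
  have hsurj : Function.Surjective φ := fun w => by
    obtain ⟨x, -, hx⟩ := exists_mulVec_rev_eq h
      (fun s => if hs : (s : ℕ) < k then w ⟨s, hs⟩ else 0)
    refine ⟨⟨M *ᵥ x, x, rfl⟩, funext fun s => ?_⟩
    have := hx (Fin.castLE hkn s) s.isLt
    simpa [φ, LinearMap.funLeft] using this
  have hfin : Module.finrank ℝ (LinearMap.range M.mulVecLin) =
      Module.finrank ℝ (Fin k → ℝ) := by
    refine le_antisymm ?_ (LinearMap.finrank_le_finrank_of_surjective hsurj)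
    simpa [Matrix.rank] using hrank
  have hinj := (LinearMap.injective_iff_surjective_of_finrank_eq_finrank hfin).2 hsurj
  have h0 : φ ⟨M *ᵥ v, v, rfl⟩ = φ 0 := by
    rw [map_zero]
    exact funext fun s => hv (Fin.castLE hkn s) s.isLt
  exact congrArg Subtype.val (hinj h0)

lemma exists_kernel_vector {n k : ℕ} (hkn : k ≤ n) {M : Matrix (Fin n) (Fin n) ℝ}
    (hrank : M.rank ≤ k) (h : (cornerMatrix k M).det ≠ 0) (j : Fin n) (hj : k ≤ (j : ℕ)) :
    ∃ v : Fin n → ℝ, (∀ t, j < t → v t = 0) ∧ v j ≠ 0 ∧ M *ᵥ v = 0 := by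
  obtain ⟨x, hsupp, hx⟩ := exists_mulVec_rev_eq h fun s => (M *ᵥ Pi.single j 1) s.rev
  refine ⟨Pi.single j 1 - x, fun t ht => ?_, ?_, ?_⟩
  · rw [Pi.sub_apply, Pi.single_eq_of_ne ht.ne', hsupp t (by rw [Fin.lt_def] at ht; omega),
      sub_zero]
  · simp [hsupp j hj]
  · refine mulVec_eq_zero_of_rank_le hkn hrank h fun s hs => ?_
    rw [Matrix.mulVec_sub, Pi.sub_apply, hx s hs, sub_self]

lemma exists_upperTriangular_intertwiner {n k : ℕ} (hk : 2 ≤ k) (hkn : 2 * k ≤ n) {ε : ℝ}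
    (hε : ε = 1 ∨ ε = -1) {M : Matrix (Fin n) (Fin n) ℝ} (hsq : M * M = 0) (hrank : M.rank ≤ k)
    (h : ∀ i ≤ k, (cornerMatrix i M).det ≠ 0) :
    ∃ b : Matrix (Fin n) (Fin n) ℝ, (∀ s t, t < s → b s t = 0) ∧ b.det ≠ 0 ∧
      M * b = b * Xmat n k ε := by
  have hpiv : ∀ i : Fin n, ∃ v : Fin n → ℝ, (i : ℕ) < k → (∀ t, i < t → v t = 0) ∧ v i ≠ 0 ∧
      (∀ s, s < i → (M *ᵥ v) s.rev = 0) ∧ (M *ᵥ v) i.rev = 1 := fun i => by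
    by_cases hi : (i : ℕ) < k
    · obtain ⟨v, hv⟩ := exists_pivot_vector i (h i hi.le) (h (i + 1) hi)
      exact ⟨v, fun _ => hv⟩
    · exact ⟨0, fun hi' => absurd hi' hi⟩
  have hker : ∀ j : Fin n, ∃ v : Fin n → ℝ, k ≤ (j : ℕ) →
      (∀ t, j < t → v t = 0) ∧ v j ≠ 0 ∧ M *ᵥ v = 0 := fun j => by
    by_cases hj : k ≤ (j : ℕ)
    · obtain ⟨v, hv⟩ := exists_kernel_vector (by omega) hrank (h k le_rfl) j hj
      exact ⟨v, fun _ => hv⟩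
    · exact ⟨0, fun hj' => absurd hj' hj⟩
  choose p hp using hpiv
  choose q hq using hker
  let col : Fin n → Fin n → ℝ := fun t =>
    if (t : ℕ) < k then p t else
      if (t.rev : ℕ) < k then xCoeff k ε t.rev • (M *ᵥ p t.rev) else q t
  have hrev : ∀ t : Fin n, (t : ℕ) < k → ¬ (t.rev : ℕ) < k := fun t ht => by
    rw [Fin.val_rev]; omega
  have hcol : ∀ t, (∀ s, t < s → col t s = 0) ∧ col t t ≠ 0 := fun t => by
    by_cases h1 : (t : ℕ) < k
    · simp only [col, h1, if_true]
      exact ⟨(hp t h1).1, (hp t h1).2.1⟩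
    · by_cases h2 : (t.rev : ℕ) < k
      · obtain ⟨-, -, h3, h4⟩ := hp t.rev h2
        simp only [col, h1, h2, if_true, if_false, Pi.smul_apply, smul_eq_mul]
        refine ⟨fun s hs => ?_, ?_⟩
        · have := h3 s.rev (Fin.rev_lt_rev.2 hs)
          rw [Fin.rev_rev] at this
          rw [this, mul_zero]
        · rw [Fin.rev_rev] at h4
          rw [h4, mul_one]
          exact xCoeff_ne_zero hε _
      · simp only [col, h1, h2, if_false]
        exact ⟨(hq t (not_lt.1 h1)).1, (hq t (not_lt.1 h1)).2.1⟩
  refine ⟨Matrix.of fun s t => col t s, fun s t hts => (hcol t).1 s hts, ?_, ?_⟩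
  · rw [Matrix.det_of_isUpperTriangular (M := Matrix.of fun s t => col t s)
      fun s t hts => (hcol t).1 s hts]
    exact Finset.prod_ne_zero_iff.2 fun t _ => (hcol t).2
  · ext s t
    rw [mul_Xmat_apply hk hkn]
    change (M *ᵥ col t) s = if _ then col t.rev s * _ else 0
    by_cases h1 : (t : ℕ) < k
    · simp only [col, h1, hrev t h1, if_true, if_false, Fin.rev_rev, Pi.smul_apply, smul_eq_mul]
      rw [mul_right_comm, xCoeff_mul_self hε, one_mul]
    · rw [if_neg h1]
      by_cases h2 : (t.rev : ℕ) < k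
      · simp only [col, h1, h2, if_true, if_false]
        rw [Matrix.mulVec_smul, Matrix.mulVec_mulVec, hsq]
        simp
      · simp only [col, h1, h2, if_false]
        rw [(hq t (not_lt.1 h1)).2.2, Pi.zero_apply]

lemma det_nonneg_of_commute_Xmat {k : ℕ} (hk : 2 ≤ k) {ε : ℝ} (hε : ε = 1 ∨ ε = -1)
    {z : Matrix (Fin (2 * k)) (Fin (2 * k)) ℝ}
    (hz : z * Xmat (2 * k) k ε = Xmat (2 * k) k ε * z) : 0 ≤ z.det := by
  have hentry : ∀ s t : Fin (2 * k), (t : ℕ) < k → z s t.rev * xCoeff k ε t =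
      if (s.rev : ℕ) < k then xCoeff k ε s.rev * z s.rev t else 0 := fun s t ht => by
    have := congrFun (congrFun hz s) t
    rwa [mul_Xmat_apply hk le_rfl, Xmat_mul_apply hk le_rfl, if_pos ht] at this
  have hrev : ∀ t : Fin (2 * k), (t.rev : ℕ) < k ↔ ¬ (t : ℕ) < k := fun t => by
    rw [Fin.val_rev]; omega
  let P : Fin (2 * k) → Prop := fun s => ¬ (s : ℕ) < k
  have hblock : ∀ s, ¬ P s → ∀ t, P t → z s t = 0 := fun s hs t ht => by
    have hs' : ¬ (s.rev : ℕ) < k := by rw [hrev]; exact hs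
    have := hentry s t.rev ((hrev t).2 ht)
    rw [if_neg hs', Fin.rev_rev] at this
    exact (mul_eq_zero.1 this).resolve_right (xCoeff_ne_zero hε _)
  rw [Matrix.twoBlockTriangular_det z P hblock]
  let e : {s // P s} ≃ {s // ¬ P s} :=
    Fin.revPerm.subtypeEquiv fun s => by
      simp only [P, Fin.revPerm_apply, not_not]; exact (hrev s).symm
  let c : {s // P s} → ℝ := fun s => xCoeff k ε s.1.rev
  have heq : z.toSquareBlockProp P =
      Matrix.diagonal c * (z.toSquareBlockProp fun s => ¬ P s).submatrix e e *
        Matrix.diagonal c := by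
    ext s t
    rw [Matrix.mul_diagonal, Matrix.diagonal_mul]
    have h1 := hentry s.1 t.1.rev ((hrev t.1).2 t.2)
    rw [if_pos ((hrev s.1).2 s.2), Fin.rev_rev] at h1
    have h2 := xCoeff_mul_self (k := k) hε t.1.rev
    change z s.1 t.1 = xCoeff k ε s.1.rev * z s.1.rev t.1.rev * xCoeff k ε t.1.rev
    rw [← h1, mul_assoc, h2, mul_one]
  rw [heq, Matrix.det_mul, Matrix.det_mul, Matrix.det_submatrix_equiv_self, Matrix.det_diagonal]
  set x := ∏ i, c i
  set y := (z.toSquareBlockProp fun s => ¬ P s).det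
  nlinarith [sq_nonneg (x * y)]

lemma mem_BOrb_of_det_pos {n k : ℕ} (hn : n ≠ 0) {ε : ℝ} {M b : Matrix (Fin n) (Fin n) ℝ}
    (hb : ∀ s t, t < s → b s t = 0) (hdet : 0 < b.det) (hM : M * b = b * Xmat n k ε) :
    M ∈ BOrb n k ε := by
  set r : ℝ := (b.det⁻¹) ^ ((n : ℝ)⁻¹) with hr
  have hrn : r ^ n = b.det⁻¹ := Real.rpow_inv_natCast_pow (inv_nonneg.2 hdet.le) hn
  have hdet' : (r • b).det = 1 := by
    rw [Matrix.det_smul, Fintype.card_fin, hrn, inv_mul_cancel₀ hdet.ne']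
  let B : Matrix.SpecialLinearGroup (Fin n) ℝ := ⟨r • b, hdet'⟩
  refine ⟨B, fun s t hts => ?_, ?_⟩
  · change r * b s t = 0
    rw [hb s t hts, mul_zero]
  · have h1 : B.val * (B⁻¹).val = 1 := by
      rw [← Matrix.SpecialLinearGroup.coe_mul, mul_inv_cancel, Matrix.SpecialLinearGroup.coe_one]
    have h2 : B.val * Xmat n k ε = M * B.val := by
      change (r • b) * _ = _ * (r • b)
      rw [Matrix.smul_mul, Matrix.mul_smul, hM]
    rw [h2, Matrix.mul_assoc, h1, Matrix.mul_one]

lemma Xmat_mul_self {n k : ℕ} (hk : 2 ≤ k) (hkn : 2 * k ≤ n) (ε : ℝ) :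
    Xmat n k ε * Xmat n k ε = 0 := by
  ext s t
  rw [mul_Xmat_apply hk hkn, Matrix.zero_apply]
  split_ifs with ht
  · have : ¬ (t.rev : ℕ) < k := by rw [Fin.val_rev]; omega
    rw [Xmat_apply hk hkn, if_neg fun hc => this hc.1, zero_mul]
  · rfl

lemma conj_mem_BOrb {n k : ℕ} (hk : 2 ≤ k) (hkn : 2 * k ≤ n) {ε : ℝ}
    (hε : ε = 1 ∨ ε = -1) {g : Matrix (Fin n) (Fin n) ℝ} (hg : 0 < g.det)
    (h : ∀ i ≤ k, (cornerMatrix i (g * Xmat n k ε * g⁻¹)).det ≠ 0) :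
    g * Xmat n k ε * g⁻¹ ∈ BOrb n k ε := by
  have hu : IsUnit g.det := isUnit_iff_ne_zero.2 hg.ne'
  have hgg : g⁻¹ * g = 1 := Matrix.nonsing_inv_mul g hu
  set M := g * Xmat n k ε * g⁻¹ with hM
  have hMg : g⁻¹ * M = Xmat n k ε * g⁻¹ := by
    rw [hM, Matrix.mul_assoc, ← Matrix.mul_assoc, hgg, Matrix.one_mul]
  have hsq : M * M = 0 := by
    nth_rewrite 1 [hM]
    rw [Matrix.mul_assoc, hMg, ← Matrix.mul_assoc, Matrix.mul_assoc g, Xmat_mul_self hk hkn,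
      Matrix.mul_zero, Matrix.zero_mul]
  have hrank : M.rank ≤ k := (Matrix.rank_mul_le_left _ _).trans
    ((Matrix.rank_mul_le_right _ _).trans (rank_Xmat_le hk hkn ε))
  obtain ⟨b, hb, hdet, hMb⟩ := exists_upperTriangular_intertwiner hk hkn hε hsq hrank h
  rcases hdet.lt_or_gt with hneg | hpos
  · rcases hkn.eq_or_lt with rfl | hlt
    · have hz : (g⁻¹ * b) * Xmat (2 * k) k ε = Xmat (2 * k) k ε * (g⁻¹ * b) := by
        rw [Matrix.mul_assoc, ← hMb, ← Matrix.mul_assoc, hMg, Matrix.mul_assoc]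
      have hnn := det_nonneg_of_commute_Xmat hk hε hz
      rw [Matrix.det_mul, Matrix.det_nonsing_inv, Ring.inverse_eq_inv'] at hnn
      exact absurd (mul_neg_of_pos_of_neg (inv_pos.2 hg) hneg) hnn.not_gt
    · let j : Fin n := ⟨k, by omega⟩
      let d : Fin n → ℝ := fun s => if s = j then -1 else 1
      have hd : (Matrix.diagonal d).det = -1 := by
        simp [Matrix.det_diagonal, d, Finset.prod_ite_eq']
      have hcomm : Matrix.diagonal d * Xmat n k ε = Xmat n k ε * Matrix.diagonal d := by
        ext s t
        rw [Matrix.diagonal_mul, Matrix.mul_diagonal, Xmat_apply hk hkn]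
        split_ifs with hst
        · obtain ⟨ht, rfl⟩ := hst
          have h1 : t ≠ j := fun hc => by simp [hc, j] at ht
          have h2 : t.rev ≠ j := fun hc => by
            have := congrArg Fin.val hc
            simp only [Fin.val_rev, j] at this
            omega
          simp [d, h1, h2]
        · simp
      refine mem_BOrb_of_det_pos (b := b * Matrix.diagonal d) (by omega) (fun s t hts => ?_) ?_ ?_
      · rw [Matrix.mul_diagonal, hb s t hts, zero_mul]
      · rw [Matrix.det_mul, hd]; linarith
      · rw [← Matrix.mul_assoc, hMb, Matrix.mul_assoc, ← hcomm, Matrix.mul_assoc]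
  · exact mem_BOrb_of_det_pos (by omega) hb hpos hMb

open Polynomial Filter Topology in
/-- On the line from `g` to the identity matrix, the corners of the conjugates of `Xmat n k ε` are
nonsingular near `g`, except possibly at `g` itself. -/
lemma eventually_det_cornerMatrix_ne_zero {n k : ℕ} (hk : 2 ≤ k) (hkn : 2 * k ≤ n) {ε : ℝ}
    (hε : ε = 1 ∨ ε = -1) (g : Matrix (Fin n) (Fin n) ℝ) {i : ℕ} (hi : i ≤ k) :
    ∀ᶠ t : ℝ in 𝓝[≠] 0, (cornerMatrix i
      ((g + t • (1 - g)) * Xmat n k ε * (g + t • (1 - g)).adjugate)).det ≠ 0 := by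
  let G : Matrix (Fin n) (Fin n) ℝ[X] :=
    (C : ℝ →+* ℝ[X]).mapMatrix g + (X : ℝ[X]) • (C : ℝ →+* ℝ[X]).mapMatrix (1 - g)
  let p : ℝ[X] := (cornerMatrix i (G * (C : ℝ →+* ℝ[X]).mapMatrix (Xmat n k ε) * G.adjugate)).det
  have hG : ∀ t, (evalRingHom t).mapMatrix G = g + t • (1 - g) := fun t => by
    ext a b
    simp [G, Matrix.map_apply]
  have hX : ∀ t, (evalRingHom t).mapMatrix ((C : ℝ →+* ℝ[X]).mapMatrix (Xmat n k ε)) =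
      Xmat n k ε := fun t => by
    ext a b
    simp [Matrix.map_apply]
  have hp : ∀ t, p.eval t = (cornerMatrix i
      ((g + t • (1 - g)) * Xmat n k ε * (g + t • (1 - g)).adjugate)).det := fun t => by
    rw [← coe_evalRingHom, RingHom.map_det, cornerMatrix_map, map_mul, map_mul,
      RingHom.map_adjugate, hG, hX]
  have hp0 : p ≠ 0 := fun h0 => by
    have h1 := hp 1
    rw [h0, eval_zero, one_smul, add_sub_cancel, Matrix.adjugate_one, Matrix.one_mul,
      Matrix.mul_one] at h1
    exact det_cornerMatrix_Xmat_ne_zero hk hkn hε hi h1.symm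
  have hfin : {t | p.IsRoot t}.Finite := Polynomial.finite_setOfPred_isRoot hp0
  have hclosed : IsClosed ({t | p.IsRoot t} \ {0}) := (hfin.subset Set.sdiff_subset).isClosed
  have hnhds := hclosed.compl_mem_nhds
    (show (0 : ℝ) ∉ {t | p.IsRoot t} \ {0} from fun hc => hc.2 rfl)
  filter_upwards [nhdsWithin_le_nhds hnhds, self_mem_nhdsWithin] with t ht ht0
  rw [← hp]
  exact fun hc => ht ⟨hc, ht0⟩

open Filter Topology in
theorem BOrbit_dense_in_orbit (n : ℕ) (hn : 4 ≤ n) (k : ℕ) (hk : 2 ≤ k)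
    (hkn : 2 * k ≤ n) (ε : ℝ) (hε : ε = 1 ∨ ε = -1) :
    ∀ M ∈ Orb n k ε, M ∈ closure (BOrb n k ε) := by
  rintro M ⟨g, rfl⟩
  let γ : ℝ → Matrix (Fin n) (Fin n) ℝ := fun t => g.val + t • (1 - g.val)
  have hγ0 : γ 0 = g.val := by simp [γ]
  have hγ : Continuous γ := by fun_prop
  have hdet : Continuous fun t => (γ t).det := hγ.matrix_det
  have hdet0 : (γ 0).det = 1 := by rw [hγ0]; exact g.2
  let F : ℝ → Matrix (Fin n) (Fin n) ℝ := fun t =>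
    (γ t).det⁻¹ • (γ t * Xmat n k ε * (γ t).adjugate)
  have hF : ContinuousAt F 0 :=
    (hdet.continuousAt.inv₀ (by rw [hdet0]; exact one_ne_zero)).smul
      ((hγ.matrix_mul continuous_const).matrix_mul hγ.matrix_adjugate).continuousAt
  have hF0 : F 0 = g.val * Xmat n k ε * (g⁻¹).val := by
    change (γ 0).det⁻¹ • _ = _
    rw [hdet0, inv_one, one_smul, hγ0, Matrix.SpecialLinearGroup.coe_inv]
  rw [← hF0]
  refine mem_closure_of_tendsto (hF.tendsto.mono_left nhdsWithin_le_nhds : Tendsto F (𝓝[≠] 0) _) ?_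
  have hpos : ∀ᶠ t in 𝓝[≠] (0 : ℝ), 0 < (γ t).det :=
    (hdet.continuousAt.eventually_const_lt (hdet0 ▸ one_pos : 0 < (γ 0).det)).filter_mono
      nhdsWithin_le_nhds
  have hcorner : ∀ᶠ t in 𝓝[≠] (0 : ℝ), ∀ i ∈ Finset.range (k + 1),
      (cornerMatrix i (γ t * Xmat n k ε * (γ t).adjugate)).det ≠ 0 :=
    (Finset.eventually_all _).2 fun i hi => eventually_det_cornerMatrix_ne_zero hk hkn hε g.val
      (Nat.lt_succ_iff.1 (Finset.mem_range.1 hi))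
  filter_upwards [hpos, hcorner] with t ht hc
  have hFt : F t = γ t * Xmat n k ε * (γ t)⁻¹ := by
    rw [Matrix.inv_def, Ring.inverse_eq_inv', Matrix.mul_smul]
  rw [hFt]
  refine conj_mem_BOrb hk hkn hε ht fun i hi => ?_
  rw [← hFt]
  exact det_cornerMatrix_smul_ne_zero (inv_ne_zero ht.ne')
    (hc i (Finset.mem_range.2 (Nat.lt_succ_of_le hi)))
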